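/- arXiv:2208.08977 — 2 statements merged into one kernel-verified Lean document; each statement's English description precedes it below -/
import Mathlib

section
/- Let n ≥ 1 and d ≥ 2 be integers, and let f ∈ ℂ[x₁,…,xₙ] be a homogeneous polynomial of degree d whose Milnor algebra ℂ[x₁,…,xₙ]/(∂f) is finite-dimensional as a ℂ-vector space. Then for every integer k with 0 ≤ k ≤ n(d−2) there exists a monomial of degree k whose residue class in the Milnor algebra ℂ[x₁,…,xₙ]/(∂f) is nonzero. -/
open MvPolynomial Matrix

namespace MilnorAlgebra

variable {σ R : Type*} [CommRing R]

/-- Membership in an ideal generated by `a`-th powers of variables is read off the support. -/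
theorem mem_span_X_pow_image {p : MvPolynomial σ R} {s : Set σ} {a : ℕ} :
    p ∈ Ideal.span ((fun i => (X i : MvPolynomial σ R) ^ a) '' s) ↔
      ∀ m ∈ p.support, ∃ i ∈ s, a ≤ m i := by
  have h := mem_ideal_span_monomial_image (R := R) (x := p)
    (s := (fun i => Finsupp.single i a) '' s)
  rw [Set.image_image] at h
  simpa [X_pow_eq_monomial] using h

/-- A variable is a nonzerodivisor modulo powers of other variables. -/
theorem mem_span_X_pow_image_of_mul_X_mem {p : MvPolynomial σ R} {s : Set σ} {a : ℕ} {i : σ}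
    (hi : i ∉ s) (h : p * X i ∈ Ideal.span ((fun j => (X j : MvPolynomial σ R) ^ a) '' s)) :
    p ∈ Ideal.span ((fun j => (X j : MvPolynomial σ R) ^ a) '' s) := by
  rw [mem_span_X_pow_image] at h ⊢
  intro m hm
  have hm' : m + Finsupp.single i 1 ∈ (p * X i).support := by
    rw [mem_support_iff, coeff_mul_X]
    exact mem_support_iff.mp hm
  obtain ⟨j, hj, hle⟩ := h _ hm'
  have hij : i ≠ j := fun h => hi (h ▸ hj)
  exact ⟨j, hj, by simpa [Finsupp.single_apply, hij] using hle⟩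

/-- A homogeneous ideal of finite codimension contains a power of each variable. -/
theorem exists_X_pow_mem {τ K : Type*} [Field K] {g : τ → MvPolynomial σ K} {e : ℕ}
    (hg : ∀ i, (g i).IsHomogeneous e)
    (hfin : FiniteDimensional K (MvPolynomial σ K ⧸ Ideal.span (Set.range g))) (i : σ) :
    ∃ m, X i ^ m ∈ Ideal.span (Set.range g) := by
  set J := Ideal.span (Set.range g) with hJ
  let _ : GradedAlgebra (homogeneousSubmodule σ K) := gradedAlgebra
  have hhom : J.IsHomogeneous (homogeneousSubmodule σ K) := by
    refine Ideal.homogeneous_span _ _ ?_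
    rintro _ ⟨j, rfl⟩
    exact ⟨e, hg j⟩
  obtain ⟨p, hp0, hp⟩ := Algebra.IsAlgebraic.isAlgebraic (R := K) (Ideal.Quotient.mk J (X i))
  have hpJ : Polynomial.aeval (X i) p ∈ J := by
    rw [← Ideal.Quotient.eq_zero_iff_mem, ← hp]
    exact (Polynomial.aeval_algHom_apply (Ideal.Quotient.mkₐ K J) (X i) p).symm
  have hcomp : homogeneousComponent p.natDegree (Polynomial.aeval (X i) p) ∈ J :=
    homogeneousComponent_mem_of_mem hhom hpJ _
  refine ⟨p.natDegree, ?_⟩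
  have hterm : ∀ k, homogeneousComponent p.natDegree
      (p.coeff k • (X i : MvPolynomial σ K) ^ k) =
        if k = p.natDegree then p.coeff k • (X i : MvPolynomial σ K) ^ k else 0 := fun k => by
    rw [map_smul, homogeneousComponent_of_mem (isHomogeneous_X_pow i k)]
    by_cases hk : k = p.natDegree
    · rw [if_pos hk.symm, if_pos hk]
    · rw [if_neg (Ne.symm hk), if_neg hk, smul_zero]
  rw [Polynomial.aeval_eq_sum_range, map_sum, Finset.sum_congr rfl fun k _ => hterm k,
    Finset.sum_ite_eq', if_pos (by simp), smul_eq_C_mul] at hcomp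
  have h := J.mul_mem_left (C (p.leadingCoeff)⁻¹) hcomp
  rwa [← mul_assoc, ← C_mul, Polynomial.coeff_natDegree,
    inv_mul_cancel₀ (Polynomial.leadingCoeff_ne_zero.mpr hp0), C_1, one_mul] at h

/-- The Hessian matrix of `f`, divided by `d - 1` where `d` is the degree of `f`, maps the vector
of variables to the gradient. -/
theorem inv_smul_hessian_mulVec_X [Fintype σ] {K : Type*} [Field K] [CharZero K] {d : ℕ} (hd : 2 ≤ d)
    {f : MvPolynomial σ K} (hf : f.IsHomogeneous d) :
    (Matrix.of fun i j => C ((d - 1 : ℕ) : K)⁻¹ * pderiv j (pderiv i f)) *ᵥ X =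
      fun i => pderiv i f := by
  funext i
  have h0 : ((d - 1 : ℕ) : K) ≠ 0 := Nat.cast_ne_zero.mpr (by omega)
  have h := (hf.pderiv (i := i)).sum_X_mul_pderiv
  simp only [mulVec, dotProduct, of_apply, mul_assoc, ← Finset.mul_sum]
  simp_rw [mul_comm _ (X _), h, nsmul_eq_mul, ← mul_assoc]
  rw [← map_natCast (C : K →+* MvPolynomial σ K), ← C_mul, inv_mul_cancel₀ h0, C_1, one_mul]

variable [Fintype σ] [DecidableEq σ]

/-- Cramer's rule: the determinant multiplies `v` into any ideal containing the entries
of `A *ᵥ v`. -/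
theorem det_mul_mem_of_mulVec_mem {S : Type*} [CommRing S] {I : Ideal S} {A : Matrix σ σ S}
    {v : σ → S} (h : ∀ i, (A *ᵥ v) i ∈ I) (j : σ) : A.det * v j ∈ I := by
  have hv : A.adjugate *ᵥ (A *ᵥ v) = A.det • v := by
    rw [mulVec_mulVec, adjugate_mul, smul_mulVec, one_mulVec]
  have hj : A.det * v j = (A.adjugate *ᵥ (A *ᵥ v)) j := by simp [hv]
  rw [hj]
  exact I.sum_mem fun i _ => I.mul_mem_left _ (h i)

/-- Replacing row `i` of a matrix by another row `r` with the same product against the vector of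
variables does not change its determinant modulo the `a`-th powers of the variables, provided
that the matrix sends the vector of variables to their `a`-th powers. -/
theorem det_sub_det_updateRow_mem {a : ℕ} {A : Matrix σ σ (MvPolynomial σ R)}
    (hA : A *ᵥ X = fun i => X i ^ a) (i : σ) {r : σ → MvPolynomial σ R}
    (hr : r ⬝ᵥ X = X i ^ a) :
    A.det - (A.updateRow i r).det ∈
      Ideal.span (Set.range fun i => (X i : MvPolynomial σ R) ^ a) := by
  have hdet : A.det - (A.updateRow i r).det = (A.updateRow i (A i - r)).det := by
    have h := det_updateRow_add A i (A i - r) r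
    rw [sub_add_cancel, updateRow_eq_self] at h
    rw [h, add_sub_cancel_right]
  have hAi : A i ⬝ᵥ X = X i ^ a := congrFun hA i
  rw [hdet]
  refine Ideal.span_mono (Set.image_subset_range _ {i}ᶜ)
    (mem_span_X_pow_image_of_mul_X_mem (i := i) (by simp) ?_)
  refine det_mul_mem_of_mulVec_mem (fun j => ?_) i
  rw [updateRow_mulVec, hA, sub_dotProduct, hAi, hr, sub_self]
  by_cases hji : j = i
  · subst hji
    simp
  · rw [Function.update_of_ne hji]
    exact Ideal.subset_span ⟨j, hji, rfl⟩

/-- A matrix sending the vector of variables to their `(a + 1)`-st powers has the same determinant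
as the diagonal one, modulo these powers. -/
theorem det_sub_prod_X_pow_mem {a : ℕ} {A : Matrix σ σ (MvPolynomial σ R)}
    (hA : A *ᵥ X = fun i => X i ^ (a + 1)) :
    A.det - ∏ i, X i ^ a ∈
      Ideal.span (Set.range fun i => (X i : MvPolynomial σ R) ^ (a + 1)) := by
  set D : Matrix σ σ (MvPolynomial σ R) := diagonal fun i => X i ^ a with hD
  have hDX : ∀ i, D i ⬝ᵥ X = X i ^ (a + 1) := fun i => by
    have h := mulVec_diagonal (fun i => (X i : MvPolynomial σ R) ^ a) X i
    rw [pow_succ, ← h]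
    rfl
  have key : ∀ s : Finset σ, A.det - (Matrix.of fun i => if i ∈ s then D i else A i).det ∈
      Ideal.span (Set.range fun i => (X i : MvPolynomial σ R) ^ (a + 1)) := by
    intro s
    induction s using Finset.induction_on with
    | empty => simp [show (Matrix.of fun i => A i) = A from rfl]
    | insert i s hi ih =>
      have hB : (Matrix.of fun i => if i ∈ s then D i else A i) *ᵥ X =
          fun i => X i ^ (a + 1) := by
        funext j
        by_cases hj : j ∈ s
        · simpa [mulVec, hj] using hDX j
        · simpa [mulVec, hj] using congrFun hA j
      have hstep := det_sub_det_updateRow_mem hB i (hDX i)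
      have hupd : (Matrix.of fun j => if j ∈ insert i s then D j else A j) =
          (Matrix.of fun j => if j ∈ s then D j else A j).updateRow i (D i) := by
        ext1 j
        by_cases hj : j = i
        · subst hj
          simp
        · simp [hj]
      rw [hupd]
      simpa using add_mem ih hstep
  have h := key Finset.univ
  simp only [Finset.mem_univ, if_true] at h
  rwa [show (Matrix.of fun i => D i) = D from rfl, hD, det_diagonal] at h

/-- If `A` expresses `g` through the variables and the ideal generated by `g` contains powers of
all the variables, then `det A` is not in that ideal. -/
theorem det_notMem_span_of_X_pow_mem [Nontrivial R] {g : σ → MvPolynomial σ R}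
    {A : Matrix σ σ (MvPolynomial σ R)} (hA : A *ᵥ X = g) {a : ℕ}
    (ha : ∀ i, X i ^ (a + 1) ∈ Ideal.span (Set.range g)) :
    A.det ∉ Ideal.span (Set.range g) := by
  intro hdet
  choose B hB using fun i => Ideal.mem_span_range_iff_exists_fun.mp (ha i)
  have hBg : (Matrix.of B) *ᵥ g = fun i => X i ^ (a + 1) := funext hB
  set I := Ideal.span (Set.range fun i => (X i : MvPolynomial σ R) ^ (a + 1)) with hI
  have hBJ : ∀ p ∈ Ideal.span (Set.range g), (Matrix.of B).det * p ∈ I := by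
    intro p hp
    induction hp using Submodule.span_induction with
    | mem p hp =>
      obtain ⟨j, rfl⟩ := hp
      refine det_mul_mem_of_mulVec_mem (fun i => ?_) j
      rw [hBg]
      exact Ideal.subset_span ⟨i, rfl⟩
    | zero => simp
    | add p q _ _ hp hq => simpa [mul_add] using add_mem hp hq
    | smul c p _ hp => simpa [mul_left_comm] using I.mul_mem_left c hp
  have hBA : (Matrix.of B * A) *ᵥ X = fun i => X i ^ (a + 1) := by
    rw [← mulVec_mulVec, hA, hBg]
  have hsub := det_sub_prod_X_pow_mem hBA
  have hprod : (∏ i, (X i : MvPolynomial σ R) ^ a) ∈ I := by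
    have h := hBJ _ hdet
    rw [← det_mul] at h
    simpa using sub_mem h hsub
  have hmon : (∏ i, (X i : MvPolynomial σ R) ^ a) =
      monomial (Finsupp.equivFunOnFinite.symm fun _ => a) 1 := by
    rw [monomial_eq, Finsupp.prod_fintype _ _ (by simp)]
    simp
  rw [hmon, hI, ← Set.image_univ, mem_span_X_pow_image] at hprod
  obtain ⟨i, -, hi⟩ := hprod (Finsupp.equivFunOnFinite.symm fun _ => a)
    (by classical simp [mem_support_iff])
  simp at hi

/-- The determinant of a matrix of homogeneous polynomials of degree `e` is homogeneous. -/
theorem isHomogeneous_det {A : Matrix σ σ (MvPolynomial σ R)} {e : ℕ}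
    (hA : ∀ i j, (A i j).IsHomogeneous e) : A.det.IsHomogeneous (Fintype.card σ * e) := by
  rw [det_apply]
  refine IsHomogeneous.sum _ _ _ fun τ _ => ?_
  have h : (∏ i, A (τ i) i).IsHomogeneous (Fintype.card σ * e) := by
    simpa using IsHomogeneous.prod Finset.univ (fun i => A (τ i) i) (fun _ => e)
      fun i _ => hA _ _
  rcases Int.units_eq_one_or (Equiv.Perm.sign τ) with hs | hs
  · simpa [hs] using h
  · simpa [hs] using h.neg

end MilnorAlgebra


/-- For a homogeneous polynomial `f` of degree `d ≥ 2` in `n ≥ 1`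
variables over `ℂ` whose Milnor algebra `ℂ[x]/(∂f)` is finite-dimensional, every degree
`k ≤ n (d-2)` supports a monomial with nonzero residue class in the Milnor algebra. -/
theorem nonzero_monomial_in_milnor_algebra
    (n d : ℕ) (hn : 1 ≤ n) (hd : 2 ≤ d)
    (f : MvPolynomial (Fin n) ℂ) (hf : f.IsHomogeneous d)
    (J : Ideal (MvPolynomial (Fin n) ℂ))
    (hJ : J = Ideal.span (Set.range fun i => MvPolynomial.pderiv i f))
    (hfin : FiniteDimensional ℂ (MvPolynomial (Fin n) ℂ ⧸ J)) :
    ∀ k : ℕ, k ≤ n * (d - 2) →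
      ∃ ν : Fin n →₀ ℕ, (∑ i, ν i) = k ∧
        Ideal.Quotient.mk J (MvPolynomial.monomial ν (1 : ℂ)) ≠ 0 := by
  intro k hk
  by_contra! hcon
  have hhom : ∀ i, (pderiv i f).IsHomogeneous (d - 1) := fun i => hf.pderiv
  subst hJ
  choose m hm using MilnorAlgebra.exists_X_pow_mem hhom hfin
  have ha : ∀ i, (X i : MvPolynomial (Fin n) ℂ) ^ (∑ j, m j + 1) ∈
      Ideal.span (Set.range fun i => pderiv i f) := fun i =>
    Ideal.pow_mem_of_pow_mem _ (hm i)
      ((Finset.single_le_sum (fun j _ => Nat.zero_le (m j)) (Finset.mem_univ i)).trans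
        (Nat.le_succ _))
  refine MilnorAlgebra.det_notMem_span_of_X_pow_mem
    (MilnorAlgebra.inv_smul_hessian_mulVec_X hd hf) ha ?_
  have hle : idealOfVars (Fin n) ℂ ^ k ≤ Ideal.span (Set.range fun i => pderiv i f) := by
    rw [pow_idealOfVars_eq_span, Ideal.span_le]
    rintro _ ⟨ν, hν, rfl⟩
    refine Ideal.Quotient.eq_zero_iff_mem.mp (hcon ν ?_)
    rw [← Finsupp.degree_eq_sum]
    exact hν
  refine hle ((mem_pow_idealOfVars_iff _ _).mpr fun ν hν => hk.trans ?_)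
  have hdet := MilnorAlgebra.isHomogeneous_det
    (A := Matrix.of fun i j => C ((d - 1 : ℕ) : ℂ)⁻¹ * pderiv j (pderiv i f)) (e := d - 2)
    fun i j => by simpa [Nat.sub_sub] using ((hhom i).pderiv (i := j)).C_mul _
  have hweight : Finsupp.weight (fun _ => 1) ν = Fintype.card (Fin n) * (d - 2) :=
    hdet (mem_support_iff.mp hν)
  rw [Fintype.card_fin, ← Finsupp.degree_eq_weight_one] at hweight
  exact hweight.ge
end

section
/- Let a₁,…,a₆ be pairwise coprime odd integers with aᵢ ≥ 3 for all i, and let ν₁,…,ν₆ be integers with 0 ≤ νᵢ ≤ 2aᵢ−2 for all i. If Σ_{i=1}^{6} (νᵢ+1)/(2aᵢ) lies in (1/2)ℤ (i.e. twice this sum is an integer), then νᵢ = aᵢ−1 for every i, and in that case Σ_{i=1}^{6} (νᵢ+1)/(2aᵢ) = 3. -/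
/-- If a sum of fractions with pairwise coprime nonzero denominators is an integer, then every
fraction is an integer. -/
theorem dvd_of_sum_div_eq_intCast {ι : Type*} [Fintype ι] [DecidableEq ι]
    (a b : ι → ℤ) (ha : ∀ i, a i ≠ 0) (hcop : Pairwise fun i j => IsCoprime (a i) (a j))
    (m : ℤ) (h : ∑ i, (b i : ℚ) / a i = m) (j : ι) : a j ∣ b j := by
  have hsum : ∑ i, b i * ∏ k ∈ Finset.univ.erase i, a k = m * ∏ k, a k := by
    have hprod (i : ι) : (a i : ℚ) * ∏ k ∈ Finset.univ.erase i, (a k : ℚ) = ∏ k, (a k : ℚ) :=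
      Finset.mul_prod_erase _ (fun k => (a k : ℚ)) (Finset.mem_univ i)
    have hcast : ∑ i, (b i : ℚ) * ∏ k ∈ Finset.univ.erase i, (a k : ℚ) =
        m * ∏ k, (a k : ℚ) := by
      rw [← h, Finset.sum_mul]
      refine Finset.sum_congr rfl fun i _ => ?_
      have hi : (a i : ℚ) ≠ 0 := by exact_mod_cast ha i
      rw [← hprod i]
      field_simp
    exact_mod_cast hcast
  have hdvd : a j ∣ b j * ∏ k ∈ Finset.univ.erase j, a k := by
    rw [← Finset.add_sum_erase _ _ (Finset.mem_univ j)] at hsum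
    refine (dvd_add_left (Finset.dvd_sum fun i hi => ?_)).mp
      (hsum ▸ (Finset.dvd_prod_of_mem a (Finset.mem_univ j)).mul_left m)
    exact (Finset.dvd_prod_of_mem a
      (Finset.mem_erase.mpr ⟨(Finset.ne_of_mem_erase hi).symm, Finset.mem_univ j⟩)).mul_left _
  exact (IsCoprime.prod_right fun k hk =>
    hcop (Finset.ne_of_mem_erase hk).symm).dvd_of_dvd_mul_right hdvd

/-- For pairwise coprime odd integers `a₁, …, a₆` with `aᵢ ≥ 3` and
integers `0 ≤ νᵢ ≤ 2aᵢ − 2`, if the shifted weighted degree `Σᵢ (νᵢ+1)/(2aᵢ)` lies in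
`(1/2)ℤ` then `νᵢ = aᵢ − 1` for all `i`, and the sum equals `3`. -/
theorem spectral_number_in_half_integers
    (a : Fin 6 → ℕ) (hodd : ∀ i, Odd (a i)) (h3 : ∀ i, 3 ≤ a i)
    (hcop : ∀ i j, i ≠ j → Nat.Coprime (a i) (a j))
    (ν : Fin 6 → ℤ) (hν0 : ∀ i, 0 ≤ ν i) (hν : ∀ i, ν i ≤ 2 * (a i : ℤ) - 2)
    (hint : ∃ m : ℤ, 2 * (∑ i, ((ν i : ℚ) + 1) / (2 * (a i : ℚ))) = m) :
    (∀ i, ν i = (a i : ℤ) - 1) ∧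
    (∑ i, ((ν i : ℚ) + 1) / (2 * (a i : ℚ))) = 3 := by
  obtain ⟨m, hm⟩ := hint
  have hm' : ∑ i, (((ν i + 1 : ℤ) : ℚ)) / ((a i : ℤ) : ℚ) = m := by
    rw [← hm, Finset.mul_sum]
    refine Finset.sum_congr rfl fun i _ => ?_
    push_cast
    field_simp
  have hν_eq (i : Fin 6) : ν i = (a i : ℤ) - 1 := by
    have ha := h3 i
    obtain ⟨c, hc⟩ := dvd_of_sum_div_eq_intCast (fun i => (a i : ℤ)) (fun i => ν i + 1)
      (fun i => by have := h3 i; omega)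
      (fun i j hij => Nat.isCoprime_iff_coprime.mpr (hcop i j hij)) m hm' i
    have h0 := hν0 i
    have h1 := hν i
    have hc0 : 0 < c := by by_contra! hneg; nlinarith
    have hc2 : c < 2 := by by_contra! hge; nlinarith
    obtain rfl : c = 1 := by omega
    linarith
  refine ⟨hν_eq, ?_⟩
  have hterm (i : Fin 6) : ((ν i : ℚ) + 1) / (2 * (a i : ℚ)) = 1 / 2 := by
    have ha : (a i : ℚ) ≠ 0 := by have := h3 i; positivity
    rw [hν_eq i]
    push_cast
    field_simp
    ring
  simp only [hterm]
  norm_num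
end
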